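/- arXiv:2403.00844 — 7 statements merged into one kernel-verified Lean document; each statement's English description precedes it below -/
import Mathlib

section
/- Suppose a user has n⁺ positive items and n⁻ negative items with pairwise distinct scores, and let K be an integer with K < n⁺ and K < n⁻. Then Recall@K ≥ (1/n⁺)·⌊K − √(K² − n⁺·n⁻·LLPAUC(K/n⁺, K/n⁻))⌋, where ⌊·⌋ is the floor function and √ is the real square root. -/
open Finset

open scoped Classical

noncomputable section

/-- The `K` highest-scoring items under the score function `f`: those items
with fewer than `K` items scoring strictly higher (with pairwise distinct
scores these are exactly the top `K` items, provided `K ≤ card`). -/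
def topK {α : Type*} [Fintype α] (K : ℕ) (f : α → ℝ) : Finset α :=
  Finset.univ.filter fun a => (Finset.univ.filter fun b => f a < f b).card < K

/-- Empirical LLPAUC at `(α, β) = (K/n⁺, K/n⁻)`: the fraction (over all
`n⁺ · n⁻` pairs) of pairs `(i, j)` where `i` is one of the `K` highest-scoring
positive items, `j` is one of the `K` highest-scoring negative items, and
`i`'s score exceeds `j`'s score. -/
def llpauc (np nn K : ℕ) (p : Fin np → ℝ) (q : Fin nn → ℝ) : ℝ :=
  (((topK K p ×ˢ topK K q).filter fun ij => q ij.2 < p ij.1).card : ℝ) /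
    ((np : ℝ) * (nn : ℝ))

/-- Empirical OPAUC at `β = K/n⁻`: the fraction (over all `n⁺ · n⁻` pairs) of
pairs `(i, j)` where `i` is any positive item, `j` is one of the `K`
highest-scoring negative items, and `i`'s score exceeds `j`'s score. -/
def opauc (np nn K : ℕ) (p : Fin np → ℝ) (q : Fin nn → ℝ) : ℝ :=
  (((Finset.univ ×ˢ topK K q).filter fun ij : Fin np × Fin nn =>
      q ij.2 < p ij.1).card : ℝ) / ((np : ℝ) * (nn : ℝ))

/-- The number of positive items among the `K` highest-scoring items overall
(positives scored by `p`, negatives scored by `q`). -/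
def hitNum (np nn K : ℕ) (p : Fin np → ℝ) (q : Fin nn → ℝ) : ℕ :=
  (Finset.univ.filter fun i : Fin np =>
    (Finset.univ.filter fun x : Fin np ⊕ Fin nn =>
      p i < Sum.elim p q x).card < K).card

/-- Recall@K: the number of positive items among the `K` highest-scoring items
overall, divided by the number `n⁺` of positive items. -/
def recallK (np nn K : ℕ) (p : Fin np → ℝ) (q : Fin nn → ℝ) : ℝ :=
  (hitNum np nn K p q : ℝ) / (np : ℝ)

/-- Precision@K: the number of positive items among the `K` highest-scoring
items overall, divided by `K`. -/
def precisionK (np nn K : ℕ) (p : Fin np → ℝ) (q : Fin nn → ℝ) : ℝ :=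
  (hitNum np nn K p q : ℝ) / (K : ℝ)

/-- The number of elements scoring strictly higher is strictly decreasing in the score. -/
theorem card_filter_lt_lt_of_lt {α : Type*} [Fintype α] (f : α → ℝ) {a b : α} (h : f a < f b) :
    (univ.filter fun c => f b < f c).card < (univ.filter fun c => f a < f c).card := by
  apply card_lt_card
  rw [ssubset_iff_of_subset]
  · exact ⟨b, by simp [h]⟩
  · intro c hc
    simp only [mem_filter, mem_univ, true_and] at hc ⊢
    exact h.trans hc

/-- Under an injective score, `topK K f` has exactly `K` elements. -/
theorem card_topK {α : Type*} [Fintype α] (K : ℕ) (f : α → ℝ) (hf : Function.Injective f)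
    (hK : K ≤ Fintype.card α) : (topK K f).card = K := by
  set r : α → ℕ := fun a => (univ.filter fun b => f a < f b).card with hr
  have hinj : Function.Injective r := by
    intro a b hab
    by_contra hne
    rcases lt_or_gt_of_ne (hf.ne hne) with h | h
    · exact (card_filter_lt_lt_of_lt f h).ne' hab
    · exact (card_filter_lt_lt_of_lt f h).ne hab
  have himage : univ.image r = range (Fintype.card α) := by
    apply eq_of_subset_of_card_le
    · intro n hn
      obtain ⟨a, -, rfl⟩ := mem_image.1 hn
      exact mem_range.2 (card_lt_univ_of_notMem (x := a) (by simp))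
    · rw [card_image_of_injective _ hinj, card_range, card_univ]
  have htop : (topK K f).image r = range K := by
    ext n
    constructor
    · intro hn
      obtain ⟨a, ha, rfl⟩ := mem_image.1 hn
      exact mem_range.2 (mem_filter.1 ha).2
    · intro hn
      have hn' : n ∈ univ.image r :=
        himage ▸ mem_range.2 ((mem_range.1 hn).trans_le hK)
      obtain ⟨a, -, rfl⟩ := mem_image.1 hn'
      exact mem_image_of_mem r (mem_filter.2 ⟨mem_univ a, mem_range.1 hn⟩)
  rw [← card_image_of_injective _ hinj, htop, card_range]

/-- Composing the score with an injection can only enlarge the preimage of `topK`. -/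
theorem mem_topK_comp_of_mem_topK {α β : Type*} [Fintype α] [Fintype β] {K : ℕ} {f : β → ℝ}
    {g : α → β} (hg : Function.Injective g) {a : α} (h : g a ∈ topK K f) :
    a ∈ topK K (f ∘ g) := by
  simp only [topK, mem_filter, mem_univ, true_and] at h ⊢
  refine lt_of_le_of_lt (card_le_card_of_injOn g ?_ hg.injOn) h
  intro b hb
  simpa using hb

/-- An element scoring higher than a member of `topK K f` is itself in `topK K f`. -/
theorem mem_topK_of_lt {α : Type*} [Fintype α] {K : ℕ} {f : α → ℝ} {a b : α}
    (ha : a ∈ topK K f) (h : f a < f b) : b ∈ topK K f := by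
  simp only [topK, mem_filter, mem_univ, true_and] at ha ⊢
  exact (card_filter_lt_lt_of_lt f h).trans ha

theorem hitNum_eq_card_toLeft (np nn K : ℕ) (p : Fin np → ℝ) (q : Fin nn → ℝ) :
    hitNum np nn K p q = (topK K (Sum.elim p q)).toLeft.card := by
  unfold hitNum
  congr 1
  ext i
  simp only [topK, mem_toLeft, mem_filter, mem_univ, true_and, Sum.elim_inl]
  rfl

theorem hitNum_le (np nn K : ℕ) (p : Fin np → ℝ) (q : Fin nn → ℝ)
    (hinj : Function.Injective (Sum.elim p q)) (hK : K ≤ np + nn) : hitNum np nn K p q ≤ K := by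
  have h := card_toLeft_add_card_toRight (u := topK K (Sum.elim p q))
  rw [card_topK K _ hinj (by simpa using hK)] at h
  rw [hitNum_eq_card_toLeft]
  omega

/-- Each of the `K - hitNum` top positives missed by the overall top `K` scores below each of the
`K - hitNum` negatives in the overall top `K`. -/
theorem card_correct_pairs_add_sq_le (np nn K : ℕ) (p : Fin np → ℝ) (q : Fin nn → ℝ)
    (hinj : Function.Injective (Sum.elim p q)) (hKp : K ≤ np) (hKn : K ≤ nn) :
    ((topK K p ×ˢ topK K q).filter fun ij => q ij.2 < p ij.1).card
      + (K - hitNum np nn K p q) ^ 2 ≤ K ^ 2 := by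
  set T := topK K (Sum.elim p q) with hT
  have hp : Function.Injective p := hinj.comp Sum.inl_injective
  have hq : Function.Injective q := hinj.comp Sum.inr_injective
  have hA : (topK K p).card = K := card_topK K p hp (by simpa using hKp)
  have hB : (topK K q).card = K := card_topK K q hq (by simpa using hKn)
  have hTcard : T.toLeft.card + T.toRight.card = K := by
    rw [card_toLeft_add_card_toRight, hT, card_topK K _ hinj (by simp; omega)]
  have hl : T.toLeft ⊆ topK K p := fun i hi =>
    mem_topK_comp_of_mem_topK (f := Sum.elim p q) Sum.inl_injective (mem_toLeft.1 hi)
  have hr : T.toRight ⊆ topK K q := fun j hj =>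
    mem_topK_comp_of_mem_topK (f := Sum.elim p q) Sum.inr_injective (mem_toRight.1 hj)
  have hdisj : Disjoint ((topK K p ×ˢ topK K q).filter fun ij => q ij.2 < p ij.1)
      ((topK K p \ T.toLeft) ×ˢ T.toRight) := by
    rw [disjoint_left]
    rintro ⟨i, j⟩ h₁ h₂
    rw [mem_product, mem_sdiff] at h₂
    exact h₂.1.2 (mem_toLeft.2 (mem_topK_of_lt (mem_toRight.1 h₂.2) (mem_filter.1 h₁).2))
  have hsub := card_le_card (union_subset (filter_subset (fun ij => q ij.2 < p ij.1) _)
    (product_subset_product (sdiff_subset (s := topK K p) (t := T.toLeft)) hr))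
  rw [card_union_of_disjoint hdisj, card_product, card_product, card_sdiff_of_subset hl, hA, hB]
    at hsub
  rw [hitNum_eq_card_toLeft, ← hT, sq, sq]
  rwa [show T.toRight.card = K - T.toLeft.card by omega] at hsub

/-- with pairwise distinct scores and `K < n⁺`, `K < n⁻`,
`Recall@K ≥ (1/n⁺)·⌊K − √(K² − n⁺·n⁻·LLPAUC(K/n⁺, K/n⁻))⌋`. -/
theorem recall_ge_llpauc_floor_bound (np nn K : ℕ) (p : Fin np → ℝ) (q : Fin nn → ℝ)
    (hinj : Function.Injective (Sum.elim p q)) (hKp : K < np) (hKn : K < nn) :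
    (1 / (np : ℝ)) *
        ((⌊(K : ℝ) - Real.sqrt ((K : ℝ) ^ 2 - (np : ℝ) * (nn : ℝ) * llpauc np nn K p q)⌋ : ℤ) : ℝ)
      ≤ recallK np nn K p q := by
  have hnp : (0 : ℝ) < np := by exact_mod_cast (Nat.zero_le K).trans_lt hKp
  have hnn : (0 : ℝ) < nn := by exact_mod_cast (Nat.zero_le K).trans_lt hKn
  have hle := hitNum_le np nn K p q hinj (by omega)
  have hcard := card_correct_pairs_add_sq_le np nn K p q hinj hKp.le hKn.le
  rw [recallK, one_div_mul_eq_div]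
  gcongr
  refine (Int.floor_le _).trans ?_
  rw [sub_le_comm]
  apply Real.le_sqrt_of_sq_le
  rw [llpauc, mul_div_cancel₀ _ (by positivity), le_sub_iff_add_le', ← Nat.cast_sub hle]
  exact_mod_cast hcard
end
end

section
/- Suppose a user has n⁺ positive items and n⁻ negative items with pairwise distinct scores, and let K be an integer with K < n⁺ and K < n⁻. Then Recall@K ≤ (1/n⁺)·⌈√(n⁺·n⁻·LLPAUC(K/n⁺, K/n⁻))⌉, where ⌈·⌉ is the ceiling function and √ is the real square root. -/
open Finset

open scoped Classical

noncomputable section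

/-- With at least `K` items available, at least `K` of them are among the top `K`, even in the
presence of ties. -/
theorem le_card_topK {α : Type*} [Fintype α] {K : ℕ} (f : α → ℝ) (hK : K ≤ Fintype.card α) :
    K ≤ (topK K f).card := by
  by_contra! h
  have hne : (topK K f)ᶜ.Nonempty := by
    rw [← Finset.card_pos, Finset.card_compl]
    omega
  obtain ⟨a, ha, hmax⟩ := Finset.exists_max_image _ f hne
  refine Finset.mem_compl.1 ha (Finset.mem_filter.2 ⟨Finset.mem_univ _, lt_of_le_of_lt ?_ h⟩)
  refine Finset.card_le_card fun b hb => ?_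
  by_contra hb'
  exact (hmax b (Finset.mem_compl.2 hb')).not_gt (Finset.mem_filter.1 hb).2

/-- Every hit outranks at least as many of the top `K` negatives as there are hits. -/
theorem hitNum_mul_self_le_card_pairs {np nn K : ℕ} {p : Fin np → ℝ} {q : Fin nn → ℝ}
    (hinj : Function.Injective (Sum.elim p q)) (hKn : K ≤ nn) :
    hitNum np nn K p q * hitNum np nn K p q ≤
      ((topK K p ×ˢ topK K q).filter fun ij => q ij.2 < p ij.1).card := by
  unfold hitNum
  set S := Finset.univ.filter fun i : Fin np =>
    (Finset.univ.filter fun x : Fin np ⊕ Fin nn => p i < Sum.elim p q x).card < K with hS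
  rcases S.eq_empty_or_nonempty with h0 | hne
  · simp [h0]
  obtain ⟨m, hm, hmin⟩ := Finset.exists_min_image S p hne
  have hp : Function.Injective p := fun a b h => Sum.inl_injective (hinj h)
  set N := Finset.univ.filter fun j : Fin nn => p m < q j with hN
  have hSN : S.card + N.card ≤ K := by
    have hsub : (S.erase m).disjSum N ⊆
        Finset.univ.filter fun x : Fin np ⊕ Fin nn => p m < Sum.elim p q x := by
      rintro (i | j) hx
      · rw [Finset.inl_mem_disjSum, Finset.mem_erase] at hx
        exact Finset.mem_filter.2 ⟨Finset.mem_univ _,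
          lt_of_le_of_ne (hmin i hx.2) fun h => hx.1 (hp h).symm⟩
      · rw [Finset.inr_mem_disjSum] at hx
        exact Finset.mem_filter.2 ⟨Finset.mem_univ _, (Finset.mem_filter.1 hx).2⟩
    have hcard := Finset.card_le_card hsub
    have hlt := (Finset.mem_filter.1 hm).2
    rw [Finset.card_disjSum, Finset.card_erase_of_mem hm] at hcard
    have := Finset.card_pos.2 hne
    omega
  have hT : S.card ≤ (topK K q \ N).card := by
    have h1 : K ≤ (topK K q).card := le_card_topK q (by simpa using hKn)
    have h2 := Finset.le_card_sdiff N (topK K q)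
    omega
  calc S.card * S.card ≤ S.card * (topK K q \ N).card := Nat.mul_le_mul_left _ hT
    _ = (S ×ˢ (topK K q \ N)).card := (Finset.card_product _ _).symm
    _ ≤ _ := Finset.card_le_card ?_
  rintro ⟨i, j⟩ hij
  obtain ⟨hi, hj⟩ := Finset.mem_product.1 hij
  obtain ⟨hjT, hjN⟩ := Finset.mem_sdiff.1 hj
  have hle : q j ≤ p m := not_lt.1 fun h => hjN (Finset.mem_filter.2 ⟨Finset.mem_univ _, h⟩)
  have hlt : q j < p m := lt_of_le_of_ne hle fun h =>
    Sum.inr_ne_inl (hinj (a₁ := Sum.inr j) (a₂ := Sum.inl m) h)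
  refine Finset.mem_filter.2 ⟨Finset.mem_product.2 ⟨?_, hjT⟩, hlt.trans_le (hmin i hi)⟩
  refine Finset.mem_filter.2 ⟨Finset.mem_univ _, lt_of_le_of_lt ?_ (Finset.mem_filter.1 hi).2⟩
  refine Finset.card_le_card_of_injOn Sum.inl (fun b hb => ?_) Sum.inl_injective.injOn
  exact Finset.mem_coe.2 (Finset.mem_filter.2
    ⟨Finset.mem_univ _, (Finset.mem_filter.1 (Finset.mem_coe.1 hb)).2⟩)

/-- with pairwise distinct scores and `K < n⁺`, `K < n⁻`,
`Recall@K ≤ (1/n⁺)·⌈√(n⁺·n⁻·LLPAUC(K/n⁺, K/n⁻))⌉`. -/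
theorem recall_le_llpauc_ceil_bound (np nn K : ℕ) (p : Fin np → ℝ) (q : Fin nn → ℝ)
    (hinj : Function.Injective (Sum.elim p q)) (hKp : K < np) (hKn : K < nn) :
    recallK np nn K p q ≤
      (1 / (np : ℝ)) *
        ((⌈Real.sqrt ((np : ℝ) * (nn : ℝ) * llpauc np nn K p q)⌉ : ℤ) : ℝ) := by
  have hnp : (np : ℝ) ≠ 0 := Nat.cast_ne_zero.2 (by omega)
  have hnn : (nn : ℝ) ≠ 0 := Nat.cast_ne_zero.2 (by omega)
  rw [recallK, llpauc, mul_div_cancel₀ _ (mul_ne_zero hnp hnn), div_eq_mul_one_div, mul_comm]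
  refine mul_le_mul_of_nonneg_left (le_trans ?_ (Int.le_ceil _)) (by positivity)
  refine Real.le_sqrt_of_sq_le ?_
  rw [sq]
  exact_mod_cast hitNum_mul_self_le_card_pairs hinj hKn.le
end
end

section
/- Suppose a user has n⁺ positive items and n⁻ negative items with pairwise distinct scores, and let K be an integer with 0 < K ≤ n⁺ and K ≤ n⁻. Let t be the score of the K-th highest-scoring negative item. If the number of positive items with score greater than t is at most K, then OPAUC(K/n⁻) = LLPAUC(K/n⁺, K/n⁻). -/
open Finset

open scoped Classical

noncomputable section

/-- If at least `K` items score at least `t`, then so does each of the top `K` items. -/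
theorem le_of_mem_topK {α : Type*} [Fintype α] {K : ℕ} {f : α → ℝ} {t : ℝ} {a : α}
    (ht : K ≤ (Finset.univ.filter fun b => t ≤ f b).card) (ha : a ∈ topK K f) : t ≤ f a := by
  by_contra! hlt
  rw [topK, mem_filter] at ha
  exact (ht.trans (card_le_card
    (monotone_filter_right _ fun _ _ hb => hlt.trans_le hb))).not_gt ha.2

/-- If at most `K` items score above `t`, then each of them is among the top `K` items. -/
theorem mem_topK_of_card_le {α : Type*} [Fintype α] {K : ℕ} {f : α → ℝ} {t : ℝ} {a : α}
    (ht : (Finset.univ.filter fun b => t < f b).card ≤ K) (ha : t < f a) : a ∈ topK K f := by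
  rw [topK, mem_filter]
  refine ⟨mem_univ _, (card_lt_card ?_).trans_le ht⟩
  refine (ssubset_iff_of_subset (monotone_filter_right _ fun _ _ hb => ha.trans hb)).2 ⟨a, ?_, ?_⟩
  · simpa using ha
  · simp

/-- with pairwise distinct scores and `0 < K ≤ n⁺`, `K ≤ n⁻`, if
`t = q j₀` is the score of the `K`-th highest-scoring negative item (exactly
`K` negative items have score `≥ q j₀`) and at most `K` positive items score
above `t`, then `OPAUC(K/n⁻) = LLPAUC(K/n⁺, K/n⁻)`. -/
theorem opauc_eq_llpauc (np nn K : ℕ) (p : Fin np → ℝ) (q : Fin nn → ℝ)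
    (hinj : Function.Injective (Sum.elim p q))
    (hK : 0 < K) (hKp : K ≤ np) (hKn : K ≤ nn) (j₀ : Fin nn)
    (hj₀ : (Finset.univ.filter fun j => q j₀ ≤ q j).card = K)
    (hpos : (Finset.univ.filter fun i : Fin np => q j₀ < p i).card ≤ K) :
    opauc np nn K p q = llpauc np nn K p q := by
  have hsub : ((Finset.univ ×ˢ topK K q).filter fun ij : Fin np × Fin nn =>
      q ij.2 < p ij.1) = (topK K p ×ˢ topK K q).filter fun ij => q ij.2 < p ij.1 := by
    ext ⟨i, j⟩
    simp only [mem_filter, mem_product, mem_univ, true_and]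
    refine ⟨fun ⟨hj, hij⟩ => ⟨⟨?_, hj⟩, hij⟩, fun ⟨⟨_, hj⟩, hij⟩ => ⟨hj, hij⟩⟩
    exact mem_topK_of_card_le hpos ((le_of_mem_topK hj₀.ge hj).trans_lt hij)
  rw [opauc, llpauc, hsub]
end
end

section
/- Let J be a finite set of n items with pairwise distinct scores f : J → ℝ, let k be an integer with 1 ≤ k ≤ n, and let η be the k-th largest score, so that exactly k items j satisfy f(j) ≥ η. If ℓ : ℝ → ℝ is monotone nondecreasing, then Σ_{j ∈ J, f(j) ≥ η} ℓ(f(j)) = min over s ∈ ℝ of (k·s + Σ_{j ∈ J} max(ℓ(f(j)) − s, 0)), and this minimum over s is attained. -/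
open Finset

open scoped Classical

/-- average top-k trick, min form: for a finite set `J` of `n`
items with pairwise distinct scores `f`, `1 ≤ k ≤ n`, and `η` the `k`-th
largest score (so `η` is a score and exactly `k` items satisfy `f j ≥ η`),
if `ℓ` is monotone nondecreasing then
`Σ_{f j ≥ η} ℓ (f j) = min_{s ∈ ℝ} (k·s + Σ_j max (ℓ (f j) − s) 0)`,
with the minimum attained. -/
theorem avg_topk_min {J : Type*} [Fintype J] (n k : ℕ)
    (hcard : Fintype.card J = n)
    (f : J → ℝ) (hf : Function.Injective f) (hk1 : 1 ≤ k) (hkn : k ≤ n)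
    (η : ℝ) (hηmem : ∃ j, f j = η)
    (hη : (Finset.univ.filter fun j => η ≤ f j).card = k)
    (ℓ : ℝ → ℝ) (hℓ : Monotone ℓ) :
    IsLeast (Set.range fun s : ℝ => (k : ℝ) * s + ∑ j, max (ℓ (f j) - s) 0)
      (∑ j ∈ Finset.univ.filter fun j => η ≤ f j, ℓ (f j)) := by
  have hsum (s : ℝ) : (k : ℝ) * s + ∑ j with η ≤ f j, (ℓ (f j) - s) =
      ∑ j with η ≤ f j, ℓ (f j) := by
    rw [Finset.sum_sub_distrib, Finset.sum_const, hη, nsmul_eq_mul]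
    ring
  constructor
  · refine ⟨ℓ η, ?_⟩
    dsimp only
    rw [← hsum (ℓ η), Finset.sum_filter]
    congr 1
    refine Finset.sum_congr rfl fun j _ => ?_
    split_ifs with h
    · exact max_eq_left (sub_nonneg.mpr (hℓ h))
    · exact max_eq_right (sub_nonpos.mpr (hℓ (le_of_not_ge h)))
  · rintro _ ⟨s, rfl⟩
    dsimp only
    rw [← hsum s, Finset.sum_filter]
    gcongr with j
    split_ifs
    · exact le_max_left _ _
    · exact le_max_right _ _
end

section
/- Let J be a finite set of n items with pairwise distinct scores f : J → ℝ, let k be an integer with 1 ≤ k ≤ n, and let η be the k-th largest score, so that exactly k items j satisfy f(j) ≥ η. If ℓ : ℝ → ℝ is monotone nonincreasing, then Σ_{j ∈ J, f(j) ≥ η} ℓ(f(j)) = max over s ∈ ℝ of (−k·s − Σ_{j ∈ J} max(−ℓ(f(j)) − s, 0)), and this maximum over s is attained. -/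
open Finset

open scoped Classical

/-- average top-k trick, max form: for a finite set `J` of `n`
items with pairwise distinct scores `f`, `1 ≤ k ≤ n`, and `η` the `k`-th
largest score (so `η` is a score and exactly `k` items satisfy `f j ≥ η`),
if `ℓ` is monotone nonincreasing then
`Σ_{f j ≥ η} ℓ (f j) = max_{s ∈ ℝ} (−k·s − Σ_j max (−ℓ (f j) − s) 0)`,
with the maximum attained. -/
theorem avg_topk_max {J : Type*} [Fintype J] (n k : ℕ)
    (hcard : Fintype.card J = n)
    (f : J → ℝ) (hf : Function.Injective f) (hk1 : 1 ≤ k) (hkn : k ≤ n)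
    (η : ℝ) (hηmem : ∃ j, f j = η)
    (hη : (Finset.univ.filter fun j => η ≤ f j).card = k)
    (ℓ : ℝ → ℝ) (hℓ : Antitone ℓ) :
    IsGreatest
      (Set.range fun s : ℝ => -(k : ℝ) * s - ∑ j, max (-ℓ (f j) - s) 0)
      (∑ j ∈ Finset.univ.filter fun j => η ≤ f j, ℓ (f j)) := by
  have hsum (s : ℝ) : ∑ j ∈ Finset.univ.filter (fun j => η ≤ f j), (-ℓ (f j) - s) =
      -(∑ j ∈ Finset.univ.filter fun j => η ≤ f j, ℓ (f j)) - k * s := by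
    rw [Finset.sum_sub_distrib, Finset.sum_neg_distrib, Finset.sum_const, hη, nsmul_eq_mul]
  constructor
  · have hmax : ∑ j, max (-ℓ (f j) - -ℓ η) 0 =
        ∑ j ∈ Finset.univ.filter (fun j => η ≤ f j), (-ℓ (f j) - -ℓ η) := by
      rw [Finset.sum_filter]
      refine Finset.sum_congr rfl fun j _ => ?_
      split_ifs with h
      · exact max_eq_left (by linarith [hℓ h])
      · exact max_eq_right (by linarith [hℓ (not_le.mp h).le])
    refine ⟨-ℓ η, ?_⟩
    simp only [hmax, hsum]
    ring
  · rintro _ ⟨s, rfl⟩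
    have hle : ∑ j ∈ Finset.univ.filter (fun j => η ≤ f j), (-ℓ (f j) - s) ≤
        ∑ j, max (-ℓ (f j) - s) 0 :=
      (Finset.sum_le_sum fun _ _ => le_max_left _ _).trans
        (Finset.sum_le_sum_of_subset_of_nonneg (Finset.filter_subset _ _)
          fun _ _ _ => le_max_right _ _)
    rw [hsum] at hle
    linarith
end

section
/- For any finite family of real numbers x₁, …, xₙ and any integer k with 1 ≤ k ≤ n, the sum of the k largest values among x₁, …, xₙ equals the minimum over s ∈ ℝ of (k·s + Σ_{i=1}^{n} max(xᵢ − s, 0)), and this minimum is attained (e.g., at s equal to the k-th largest value). -/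
open Finset

open scoped Classical

theorem card_filter_sub_le_fin {n k : ℕ} (hkn : k ≤ n) :
    (Finset.univ.filter fun i : Fin n => n - k ≤ (i : ℕ)).card = k := by
  have h : (Finset.univ.filter fun i : Fin n => n - k ≤ (i : ℕ)).map Fin.valEmbedding
      = Finset.Ico (n - k) n := by
    ext j
    simp only [Finset.mem_map, Finset.mem_filter, Finset.mem_univ, true_and,
      Fin.valEmbedding_apply, Finset.mem_Ico]
    constructor
    · rintro ⟨i, hi, rfl⟩
      exact ⟨hi, i.isLt⟩
    · rintro ⟨hj, hjn⟩
      exact ⟨⟨j, hjn⟩, hj, rfl⟩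
  rw [← Finset.card_map Fin.valEmbedding, h, Nat.card_Ico]
  omega

theorem card_mul_add_sum_sub {ι : Type*} (F : Finset ι) (y : ι → ℝ) (s : ℝ) :
    (F.card : ℝ) * s + ∑ i ∈ F, (y i - s) = ∑ i ∈ F, y i := by
  rw [Finset.sum_sub_distrib, Finset.sum_const, nsmul_eq_mul]
  ring

theorem sum_le_card_mul_add_sum_max {ι : Type*} [Fintype ι] (F : Finset ι) (y : ι → ℝ) (s : ℝ) :
    ∑ i ∈ F, y i ≤ (F.card : ℝ) * s + ∑ i, max (y i - s) 0 := by
  rw [← card_mul_add_sum_sub F y s]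
  gcongr
  calc ∑ i ∈ F, (y i - s) ≤ ∑ i ∈ F, max (y i - s) 0 :=
        Finset.sum_le_sum fun i _ => le_max_left _ _
    _ ≤ ∑ i, max (y i - s) 0 :=
        Finset.sum_le_univ_sum_of_nonneg fun i => le_max_right _ _

theorem card_mul_add_sum_max_eq {ι : Type*} [Fintype ι] {F : Finset ι} {y : ι → ℝ} {s : ℝ}
    (hF : ∀ i ∈ F, s ≤ y i) (hFc : ∀ i ∉ F, y i ≤ s) :
    (F.card : ℝ) * s + ∑ i, max (y i - s) 0 = ∑ i ∈ F, y i := by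
  rw [← card_mul_add_sum_sub F y s]
  congr 1
  rw [← Finset.sum_subset (Finset.subset_univ F)
    fun i _ hi => max_eq_right (sub_nonpos.2 (hFc i hi))]
  exact Finset.sum_congr rfl fun i hi => max_eq_left (sub_nonneg.2 (hF i hi))

/-- average top-k identity: for reals `x₁, …, xₙ` and
`1 ≤ k ≤ n`, the sum of the `k` largest values among the `xᵢ` (computed by
sorting `x` increasingly via `Tuple.sort` and summing its last `k` entries)
equals `min_{s ∈ ℝ} (k·s + Σᵢ max (xᵢ − s) 0)`, and the minimum is attained. -/
theorem sum_topk_eq_min (n k : ℕ) (hk1 : 1 ≤ k) (hkn : k ≤ n) (x : Fin n → ℝ) :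
    IsLeast (Set.range fun s : ℝ => (k : ℝ) * s + ∑ i, max (x i - s) 0)
      (∑ i ∈ Finset.univ.filter fun i : Fin n => n - k ≤ (i : ℕ),
        x (Tuple.sort x i)) := by
  have hcard := card_filter_sub_le_fin hkn
  have hmono : Monotone (x ∘ Tuple.sort x) := Tuple.monotone_sort x
  have hperm (s : ℝ) : ∑ i, max (x i - s) 0 = ∑ i, max (x (Tuple.sort x i) - s) 0 :=
    (Equiv.sum_comp (Tuple.sort x) fun i => max (x i - s) 0).symm
  constructor
  · refine ⟨x (Tuple.sort x ⟨n - k, by omega⟩), ?_⟩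
    have h := card_mul_add_sum_max_eq
      (F := Finset.univ.filter fun i : Fin n => n - k ≤ (i : ℕ))
      (y := fun i => x (Tuple.sort x i)) (s := x (Tuple.sort x ⟨n - k, by omega⟩))
      (fun i hi => hmono (Fin.le_def.2 (Finset.mem_filter.1 hi).2))
      fun i hi => hmono (Fin.le_def.2 (by simp at hi ⊢; omega))
    rw [hcard] at h
    simpa only [hperm] using h
  · rintro _ ⟨s, rfl⟩
    have h := sum_le_card_mul_add_sum_max
      (Finset.univ.filter fun i : Fin n => n - k ≤ (i : ℕ)) (fun i => x (Tuple.sort x i)) s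
    rw [hcard] at h
    simpa only [hperm] using h
end

section
/- Let κ > 0 and w > 4κ be real numbers, let b ∈ [0,1], s⁻ ∈ ℝ, β ∈ ℝ, let n⁻ ≥ 1 be an integer, and let f₁, …, f_{n⁻} ∈ [0,1]. Then the function F₂(γ) = (1/n⁻)·Σ_{j=1}^{n⁻} [β·s⁻ + (1/κ)·log(1 + exp(κ·((f_j − b)² + 2(1+γ)·f_j − s⁻)))] − (w+1)·γ² is strictly concave on ℝ. -/
/-- The logistic function has slope at most one. -/
theorem logistic_sub_le {x y : ℝ} (hxy : x ≤ y) :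
    Real.exp y / (1 + Real.exp y) - Real.exp x / (1 + Real.exp x) ≤ y - x := by
  have hx := Real.exp_pos x
  have hy := Real.exp_pos y
  have hexp : Real.exp (x - y) * Real.exp y = Real.exp x := by
    rw [← Real.exp_add, sub_add_cancel]
  have hlin : Real.exp y - Real.exp x ≤ (y - x) * Real.exp y := by
    nlinarith [mul_le_mul_of_nonneg_right (Real.add_one_le_exp (x - y)) hy.le]
  have hden : (y - x) * Real.exp y ≤ (y - x) * ((1 + Real.exp y) * (1 + Real.exp x)) :=
    mul_le_mul_of_nonneg_left (by nlinarith [mul_pos hx hy]) (sub_nonneg.mpr hxy)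
  rw [div_sub_div _ _ (by positivity) (by positivity), div_le_iff₀ (by positivity)]
  linarith

theorem hasDerivAt_softplus {κ : ℝ} (hκ : κ ≠ 0) (x : ℝ) :
    HasDerivAt (fun x => (1 / κ) * Real.log (1 + Real.exp (κ * x)))
      (Real.exp (κ * x) / (1 + Real.exp (κ * x))) x := by
  have h := (((((hasDerivAt_id x).const_mul κ).exp.const_add 1).log
    (by positivity)).const_mul (1 / κ))
  refine h.congr_deriv ?_
  simp only [id]
  field_simp

/-- for `κ > 0`, `w > 4κ`, `b ∈ [0,1]`, `s⁻ ∈ ℝ`, `β ∈ ℝ`,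
`n⁻ ≥ 1`, and scores `f₁, …, f_{n⁻} ∈ [0,1]`, the function
`F₂(γ) = (1/n⁻)·Σⱼ [β·s⁻ + (1/κ)·log (1 + exp (κ·((fⱼ − b)² + 2(1+γ)·fⱼ − s⁻)))] − (w+1)·γ²`
is strictly concave on `ℝ`. -/
theorem F2_strictConcaveOn (κ w b sm β : ℝ) (hκ : 0 < κ) (hw : 4 * κ < w)
    (hb : b ∈ Set.Icc (0 : ℝ) 1) (nn : ℕ) (hnn : 1 ≤ nn)
    (f : Fin nn → ℝ) (hf : ∀ j, f j ∈ Set.Icc (0 : ℝ) 1) :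
    StrictConcaveOn ℝ Set.univ (fun γ : ℝ =>
      (1 / (nn : ℝ)) *
          ∑ j, (β * sm +
            (1 / κ) *
              Real.log (1 + Real.exp (κ * ((f j - b) ^ 2 + 2 * (1 + γ) * f j - sm)))) -
        (w + 1) * γ ^ 2) := by
  have hderiv : ∀ γ : ℝ, HasDerivAt _ _ γ := fun γ =>
    ((HasDerivAt.fun_sum fun j (_ : j ∈ Finset.univ) =>
      ((hasDerivAt_softplus hκ.ne' ((f j - b) ^ 2 + 2 * (1 + γ) * f j - sm)).comp γ
        ((((((hasDerivAt_id γ).const_add 1).const_mul 2).mul_const (f j)).const_add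
          ((f j - b) ^ 2)).sub_const sm)).const_add (β * sm)).const_mul (1 / (nn : ℝ))).sub
      (((hasDerivAt_id γ).pow 2).const_mul (w + 1))
  refine StrictAnti.strictConcaveOn_univ_of_deriv
    (continuous_iff_continuousAt.mpr fun γ => (hderiv γ).continuousAt) fun x y hxy => ?_
  refine ((hderiv y).deriv.trans_lt ?_).trans_eq (hderiv x).deriv.symm
  simp only [id]
  have hn : (0 : ℝ) < nn := by exact_mod_cast hnn
  have hterm : ∀ j, Real.exp (κ * ((f j - b) ^ 2 + 2 * (1 + y) * f j - sm)) /
        (1 + Real.exp (κ * ((f j - b) ^ 2 + 2 * (1 + y) * f j - sm))) * (2 * 1 * f j) ≤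
      Real.exp (κ * ((f j - b) ^ 2 + 2 * (1 + x) * f j - sm)) /
        (1 + Real.exp (κ * ((f j - b) ^ 2 + 2 * (1 + x) * f j - sm))) * (2 * 1 * f j) +
      4 * κ * (y - x) := by
    intro j
    obtain ⟨h0, h1⟩ := hf j
    have hκxy : 0 ≤ κ * (y - x) := mul_nonneg hκ.le (sub_nonneg.mpr hxy.le)
    have hdiff := logistic_sub_le
      (x := κ * ((f j - b) ^ 2 + 2 * (1 + x) * f j - sm))
      (y := κ * ((f j - b) ^ 2 + 2 * (1 + y) * f j - sm))
      (by nlinarith [mul_nonneg hκxy h0])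
    have hsq : f j ^ 2 ≤ 1 := pow_le_one₀ h0 h1
    nlinarith [mul_le_mul_of_nonneg_right hdiff h0, mul_le_mul_of_nonneg_left hsq hκxy]
  have hsum := mul_le_mul_of_nonneg_left
    (Finset.sum_le_sum fun j (_ : j ∈ Finset.univ) => hterm j) (one_div_pos.mpr hn).le
  rw [Finset.sum_add_distrib, Finset.sum_const, Finset.card_univ, Fintype.card_fin,
    nsmul_eq_mul, mul_add (1 / (nn : ℝ)), ← mul_assoc (1 / (nn : ℝ)) (nn : ℝ), one_div_mul_cancel hn.ne'] at hsum
  refine (sub_le_sub_right hsum _).trans_lt ?_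
  norm_num
  nlinarith [mul_pos (sub_pos.mpr hxy) (sub_pos.mpr hw), mul_pos (sub_pos.mpr hxy) hκ]
end
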